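/- arXiv:1502.01616 — 3 statements merged into one kernel-verified Lean document; each statement's English description precedes it below -/
import Mathlib

section
/- Let D ≥ 1, let n : Fin D → ℕ give mode sizes, and let X, Y be order-D real tensors of size n 1 × ⋯ × n D. Then for every mode d ∈ {1,…,D}, the inner product satisfies ⟨X, Y⟩ ≤ ∑_{k=1}^{n d} σ^(d)_k(X) · σ^(d)_k(Y). -/
open scoped BigOperators Matrix

/-- The entries of `v` sorted in nonincreasing order. -/
noncomputable def sortDesc {m : ℕ} (v : Fin m → ℝ) : Fin m → ℝ :=
  fun k => (v ∘ Tuple.sort v) k.rev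

theorem gram_isHermitian {m : ℕ} {J : Type*} [Fintype J]
    (A : Matrix (Fin m) J ℝ) : (A * Aᵀ).IsHermitian := by
  ext i j
  simp [Matrix.conjTranspose_apply, Matrix.mul_apply, Matrix.transpose_apply, mul_comm]

/-- Singular values of a real matrix `A`: the square roots of the eigenvalues of
the positive semidefinite matrix `A * Aᵀ`, in nonincreasing order. -/
noncomputable def singularValues {m : ℕ} {J : Type*} [Fintype J]
    (A : Matrix (Fin m) J ℝ) : Fin m → ℝ :=
  fun k => Real.sqrt (sortDesc (gram_isHermitian A).eigenvalues k)

variable {D : ℕ} {n : Fin D → ℕ}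

/-- Inner product of two tensors. -/
noncomputable def tinner (X Y : (∀ d, Fin (n d)) → ℝ) : ℝ :=
  ∑ i : ∀ d, Fin (n d), X i * Y i

/-- Mode-`d` matricization of the tensor `X`. -/
def matricize (X : (∀ d, Fin (n d)) → ℝ) (d : Fin D) :
    Matrix (Fin (n d)) (∀ d' : {d' : Fin D // d' ≠ d}, Fin (n d')) ℝ :=
  Matrix.of fun k j =>
    X (fun d' => if h : d' = d then Fin.cast (congrArg n h.symm) k else j ⟨d', h⟩)

/-- Mode-`d` singular values of a tensor. -/
noncomputable def modeSV (X : (∀ d, Fin (n d)) → ℝ) (d : Fin D) : Fin (n d) → ℝ :=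
  singularValues (matricize X d)

/-- The multilinear (Tucker) product `X ×₁ U 1 ×₂ ⋯ ×_D U D`. -/
noncomputable def tuckerMul (X : (∀ d, Fin (n d)) → ℝ)
    (U : ∀ d, Matrix (Fin (n d)) (Fin (n d)) ℝ) : (∀ d, Fin (n d)) → ℝ :=
  fun i => ∑ j : ∀ d, Fin (n d), (∏ d, U d (i d) (j d)) * X j

/-- Rectangular "diagonal" matrix with columns indexed by an arbitrary fintype,
identified with an initial segment of `ℕ` via `Fintype.equivFin`. -/
noncomputable def rectDiagJ {m : ℕ} {J : Type*} [Fintype J]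
    (v : Fin m → ℝ) : Matrix (Fin m) J ℝ :=
  Matrix.of fun k j => if ((Fintype.equivFin J) j : ℕ) = (k : ℕ) then v k else 0

/-- Bessel's inequality for a matrix whose rows are pairwise orthogonal of norm at most one. -/
theorem dotProduct_mulVec_self_le {ι J : Type*} [Fintype ι] [DecidableEq ι] [Fintype J]
    {M : Matrix ι J ℝ} {e : ι → ℝ} (he : ∀ i, e i ≤ 1) (hM : M * Mᵀ = Matrix.diagonal e)
    (v : J → ℝ) : (M *ᵥ v) ⬝ᵥ (M *ᵥ v) ≤ v ⬝ᵥ v := by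
  set w := M *ᵥ v
  have h1 : v ⬝ᵥ (Mᵀ *ᵥ w) = w ⬝ᵥ w := by
    rw [Matrix.dotProduct_mulVec, Matrix.vecMul_transpose]
  have h2 : (Mᵀ *ᵥ w) ⬝ᵥ (Mᵀ *ᵥ w) = ∑ i, e i * (w i * w i) := by
    rw [Matrix.dotProduct_mulVec, Matrix.vecMul_transpose, Matrix.mulVec_mulVec, hM]
    simp [dotProduct, Matrix.mulVec_diagonal, mul_assoc]
  have h3 : ∑ i, e i * (w i * w i) ≤ w ⬝ᵥ w :=
    Finset.sum_le_sum fun i _ => mul_le_of_le_one_left (mul_self_nonneg _) (he i)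
  have h4 : 0 ≤ (v - Mᵀ *ᵥ w) ⬝ᵥ (v - Mᵀ *ᵥ w) :=
    Finset.sum_nonneg fun j _ => mul_self_nonneg _
  rw [sub_dotProduct, dotProduct_sub, dotProduct_sub, dotProduct_comm (Mᵀ *ᵥ w) v, h1, h2] at h4
  linarith

theorem antitone_sortDesc {m : ℕ} (v : Fin m → ℝ) : Antitone (sortDesc v) :=
  fun _ _ h => Tuple.monotone_sort v (Fin.rev_le_rev.2 h)

theorem antitone_singularValues {m : ℕ} {J : Type*} [Fintype J] (A : Matrix (Fin m) J ℝ) :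
    Antitone (singularValues A) :=
  fun _ _ h => Real.sqrt_le_sqrt (antitone_sortDesc _ h)

/-- A singular value decomposition. The left factor is orthogonal; the rows of the right factor
are pairwise orthogonal of norm at most one. -/
theorem exists_eq_mul_diagonal_singularValues_mul {m : ℕ} {J : Type*} [Fintype J]
    (A : Matrix (Fin m) J ℝ) :
    ∃ (U : Matrix (Fin m) (Fin m) ℝ) (M : Matrix (Fin m) J ℝ) (e : Fin m → ℝ),
      U * Uᵀ = 1 ∧ Uᵀ * U = 1 ∧ (∀ i, e i ≤ 1) ∧ M * Mᵀ = Matrix.diagonal e ∧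
      A = U * Matrix.diagonal (singularValues A) * M := by
  have hA := gram_isHermitian A
  let p : Equiv.Perm (Fin m) := Fin.revPerm.trans (Tuple.sort hA.eigenvalues)
  set s := singularValues A
  have hnn (i) : 0 ≤ hA.eigenvalues i := by
    have : (A * Aᵀ).PosSemidef := by
      simpa using Matrix.posSemidef_self_mul_conjTranspose A
    exact this.eigenvalues_nonneg i
  have hsq (i) : hA.eigenvalues (p i) = s i * s i := (Real.mul_self_sqrt (hnn _)).symm
  let V : Matrix (Fin m) (Fin m) ℝ := hA.eigenvectorUnitary
  have hVV : Vᵀ * V = 1 := Unitary.coe_star_mul_self hA.eigenvectorUnitary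
  have hspec : Vᵀ * (A * Aᵀ) * V = Matrix.diagonal hA.eigenvalues := by
    have h := hA.spectral_theorem
    rw [Unitary.conjStarAlgAut_apply] at h
    change A * Aᵀ = V * Matrix.diagonal hA.eigenvalues * Vᵀ at h
    refine (congrArg (fun B => Vᵀ * B * V) h).trans ?_
    simp only [Matrix.mul_assoc, hVV, Matrix.mul_one]
    rw [← Matrix.mul_assoc, hVV, Matrix.one_mul]
  let U := V.submatrix id p
  have hUU : Uᵀ * U = 1 := by
    change (Vᵀ.submatrix p id) * (V.submatrix id p) = 1
    rw [← Matrix.submatrix_mul _ _ _ _ _ Function.bijective_id, hVV, Matrix.submatrix_one_equiv]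
  have hUU' : U * Uᵀ = 1 := mul_eq_one_comm.1 hUU
  have hgram : (Uᵀ * A) * (Uᵀ * A)ᵀ = Matrix.diagonal fun i => s i * s i := by
    have h : (Vᵀ * (A * Aᵀ) * V).submatrix p p = Uᵀ * (A * Aᵀ) * U := by
      ext i j
      rfl
    rw [hspec, Matrix.submatrix_diagonal_equiv] at h
    rw [Matrix.transpose_mul, Matrix.transpose_transpose, Matrix.mul_assoc, ← Matrix.mul_assoc A,
      ← Matrix.mul_assoc, ← h]
    congr 1
    exact funext hsq
  refine ⟨U, Matrix.diagonal (fun i => (s i)⁻¹) * (Uᵀ * A),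
    fun i => (s i)⁻¹ * (s i * s i) * (s i)⁻¹, hUU', hUU, fun i => ?_, ?_, ?_⟩
  · rcases eq_or_ne (s i) 0 with h | h
    · simp [h]
    · field_simp
      exact le_rfl
  · rw [Matrix.transpose_mul, Matrix.mul_assoc, ← Matrix.mul_assoc (Uᵀ * A), hgram,
      Matrix.diagonal_transpose, Matrix.diagonal_mul_diagonal, Matrix.diagonal_mul_diagonal]
    simp only [mul_assoc]
  · have h : Matrix.diagonal s * (Matrix.diagonal (fun i => (s i)⁻¹) * (Uᵀ * A)) = Uᵀ * A := by
      ext i j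
      rw [Matrix.diagonal_mul, Matrix.diagonal_mul]
      rcases eq_or_ne (s i) 0 with h0 | h0
      · have h := congrFun₂ hgram i i
        rw [Matrix.diagonal_apply_eq, Matrix.mul_apply, h0, mul_zero] at h
        have := (Finset.sum_eq_zero_iff_of_nonneg fun j _ => mul_self_nonneg _).1 h j
          (Finset.mem_univ j)
        simp [mul_self_eq_zero.1 this]
      · rw [mul_inv_cancel_left₀ h0]
    rw [Matrix.mul_assoc, h, ← Matrix.mul_assoc, hUU', Matrix.one_mul]

/-- A nonnegative antitone tuple is a nonnegative combination of indicators of initial segments. -/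
theorem exists_eq_sum_ite_le {m : ℕ} {s : Fin m → ℝ} (hs : Antitone s) (h0 : ∀ i, 0 ≤ s i) :
    ∃ α : Fin m → ℝ, (∀ k, 0 ≤ α k) ∧ ∀ i, s i = ∑ k, if i ≤ k then α k else 0 := by
  let f : ℕ → ℝ := fun k => if h : k < m then s ⟨k, h⟩ else 0
  refine ⟨fun k => f k - f (k + 1), fun k => sub_nonneg.2 ?_, fun i => ?_⟩
  · by_cases h : (k : ℕ) + 1 < m
    · simpa [f, h] using hs (Fin.mk_le_mk.2 (Nat.le_succ _))
    · simpa [f, h] using h0 k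
  · have h : ∑ k ∈ Finset.range m, (if (i : ℕ) ≤ k then f k - f (k + 1) else 0) = f i - f m := by
      have hIco : (Finset.range m).filter (fun k => (i : ℕ) ≤ k) = Finset.Ico (i : ℕ) m := by
        ext k
        simp [and_comm]
      rw [← Finset.sum_filter, hIco, ← neg_inj, ← Finset.sum_neg_distrib, neg_sub,
        ← Finset.sum_Ico_sub f i.2.le]
      simp
    have hi : f i = s i := by simp [f]
    have hm : f m = 0 := by simp [f]
    rw [Finset.sum_range, hi, hm, sub_zero] at h
    exact h.symm

/-- A doubly substochastic bilinear form is maximal on the diagonal for antitone tuples. -/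
theorem sum_sum_mul_le_of_antitone {m : ℕ} {S : Matrix (Fin m) (Fin m) ℝ}
    (hS : ∀ i j, 0 ≤ S i j) (hrow : ∀ i, ∑ j, S i j ≤ 1) (hcol : ∀ j, ∑ i, S i j ≤ 1)
    {s t : Fin m → ℝ} (hs : Antitone s) (hs0 : ∀ i, 0 ≤ s i) (ht : Antitone t)
    (ht0 : ∀ i, 0 ≤ t i) : ∑ i, ∑ j, S i j * (s i * t j) ≤ ∑ i, s i * t i := by
  obtain ⟨α, hα, hsα⟩ := exists_eq_sum_ite_le hs hs0
  obtain ⟨β, hβ, htβ⟩ := exists_eq_sum_ite_le ht ht0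
  have hst (i j) : s i * t j =
      ∑ k, ∑ l, α k * β l * ((if i ≤ k then 1 else 0) * (if j ≤ l then 1 else 0)) := by
    rw [hsα, htβ, Finset.sum_mul_sum]
    refine Finset.sum_congr rfl fun k _ => Finset.sum_congr rfl fun l _ => ?_
    split_ifs <;> simp
  have hbound (k l : Fin m) :
      ∑ i, ∑ j, S i j * ((if i ≤ k then 1 else 0) * (if j ≤ l then 1 else 0)) ≤
        ∑ i, (if i ≤ k then 1 else 0) * (if i ≤ l then (1 : ℝ) else 0) := by
    rcases le_total k l with hkl | hkl
    · refine Finset.sum_le_sum fun i _ => ?_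
      by_cases hi : i ≤ k
      · simp only [hi, hi.trans hkl, if_true, one_mul]
        refine (Finset.sum_le_sum fun j _ => ?_).trans (hrow i)
        split_ifs <;> simp [hS]
      · simp [hi]
    · rw [Finset.sum_comm]
      refine Finset.sum_le_sum fun j _ => ?_
      by_cases hj : j ≤ l
      · simp only [hj, hj.trans hkl, if_true, mul_one]
        refine (Finset.sum_le_sum fun i _ => ?_).trans (hcol j)
        split_ifs <;> simp [hS]
      · simp [hj]
  calc ∑ i, ∑ j, S i j * (s i * t j)
      = ∑ k, ∑ l, α k * β l *
          ∑ i, ∑ j, S i j * ((if i ≤ k then 1 else 0) * (if j ≤ l then 1 else 0)) := by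
        simp only [hst, Finset.mul_sum]
        calc _ = ∑ i, ∑ k, ∑ j, ∑ l, S i j * (α k * β l *
                ((if i ≤ k then 1 else 0) * (if j ≤ l then 1 else 0))) :=
              Finset.sum_congr rfl fun i _ => Finset.sum_comm
          _ = ∑ k, ∑ i, ∑ l, ∑ j, S i j * (α k * β l *
                ((if i ≤ k then 1 else 0) * (if j ≤ l then 1 else 0))) := by
              rw [Finset.sum_comm]
              exact Finset.sum_congr rfl fun k _ => Finset.sum_congr rfl fun i _ => Finset.sum_comm
          _ = _ := by
              refine Finset.sum_congr rfl fun k _ => ?_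
              rw [Finset.sum_comm]
              simp only [mul_left_comm (S _ _)]
    _ ≤ ∑ k, ∑ l, α k * β l * ∑ i, (if i ≤ k then 1 else 0) * (if i ≤ l then (1 : ℝ) else 0) := by
        exact Finset.sum_le_sum fun k _ => Finset.sum_le_sum fun l _ =>
          mul_le_mul_of_nonneg_left (hbound k l) (mul_nonneg (hα k) (hβ l))
    _ = ∑ i, s i * t i := by
        simp only [hst, Finset.mul_sum]
        symm
        rw [Finset.sum_comm]
        exact Finset.sum_congr rfl fun k _ => Finset.sum_comm

/-- Von Neumann's trace inequality for real rectangular matrices. -/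
theorem sum_sum_mul_le_sum_singularValues {m : ℕ} {J : Type*} [Fintype J]
    (A B : Matrix (Fin m) J ℝ) :
    ∑ i, ∑ j, A i j * B i j ≤ ∑ k, singularValues A k * singularValues B k := by
  obtain ⟨U, M, e, hU, hU', he, hM, hA⟩ := exists_eq_mul_diagonal_singularValues_mul A
  obtain ⟨W, N, f, hW, hW', hf, hN, hB⟩ := exists_eq_mul_diagonal_singularValues_mul B
  set s := singularValues A
  set t := singularValues B
  have hs0 (i) : 0 ≤ s i := Real.sqrt_nonneg _
  have ht0 (i) : 0 ≤ t i := Real.sqrt_nonneg _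
  let P := Uᵀ * W
  let Q := M * Nᵀ
  have htrace : ∑ i, ∑ j, A i j * B i j = ∑ i, ∑ j, P i j * Q i j * (s i * t j) := by
    have h : ∑ i, ∑ j, A i j * B i j = Matrix.trace (A * Bᵀ) := by
      simp [Matrix.trace, Matrix.mul_apply]
    rw [h, hA, hB]
    calc _ = Matrix.trace (U * (Matrix.diagonal s * Q * Matrix.diagonal t * Wᵀ)) := by
          simp only [Matrix.transpose_mul, Matrix.diagonal_transpose, Matrix.mul_assoc, Q]
      _ = Matrix.trace (Matrix.diagonal s * Q * Matrix.diagonal t * Pᵀ) := by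
          rw [Matrix.trace_mul_comm, Matrix.mul_assoc]
          simp [P, Matrix.transpose_mul]
      _ = _ := by
          simp only [Matrix.trace, Matrix.diag, Matrix.mul_apply (N := Pᵀ), Matrix.mul_diagonal,
            Matrix.diagonal_mul, Matrix.transpose_apply]
          refine Finset.sum_congr rfl fun i _ => Finset.sum_congr rfl fun j _ => ?_
          ring
  have hProw (i) : ∑ j, P i j * P i j = 1 := by
    have h : P * Pᵀ = 1 := by
      simp only [P, Matrix.transpose_mul, Matrix.transpose_transpose]
      rw [Matrix.mul_assoc, ← Matrix.mul_assoc W, hW, Matrix.one_mul, hU']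
    simpa [Matrix.mul_apply] using congrFun₂ h i i
  have hPcol (j) : ∑ i, P i j * P i j = 1 := by
    have h : Pᵀ * P = 1 := by
      simp only [P, Matrix.transpose_mul, Matrix.transpose_transpose]
      rw [Matrix.mul_assoc, ← Matrix.mul_assoc U, hU, Matrix.one_mul, hW']
    simpa [Matrix.mul_apply] using congrFun₂ h j j
  have hMrow (i) : M i ⬝ᵥ M i ≤ 1 := by
    have h := congrFun₂ hM i i
    rw [Matrix.diagonal_apply_eq] at h
    exact h.trans_le (he i)
  have hNrow (i) : N i ⬝ᵥ N i ≤ 1 := by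
    have h := congrFun₂ hN i i
    rw [Matrix.diagonal_apply_eq] at h
    exact h.trans_le (hf i)
  have hQrow (i) : ∑ j, Q i j * Q i j ≤ 1 := by
    have hQ (j) : Q i j = (N *ᵥ M i) j := dotProduct_comm _ _
    simp only [hQ]
    exact (dotProduct_mulVec_self_le hf hN (M i)).trans (hMrow i)
  have hQcol (j) : ∑ i, Q i j * Q i j ≤ 1 :=
    (dotProduct_mulVec_self_le he hM (N j)).trans (hNrow j)
  let S : Matrix (Fin m) (Fin m) ℝ := fun i j => (P i j * P i j + Q i j * Q i j) / 2
  rw [htrace]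
  calc _ ≤ ∑ i, ∑ j, S i j * (s i * t j) := by
        gcongr with i _ j _
        · exact mul_nonneg (hs0 i) (ht0 j)
        · simp only [S]
          nlinarith [mul_self_nonneg (P i j - Q i j)]
    _ ≤ _ := by
        refine sum_sum_mul_le_of_antitone (fun i j => ?_) (fun i => ?_) (fun j => ?_)
          (antitone_singularValues A) hs0 (antitone_singularValues B) ht0
        · exact div_nonneg (add_nonneg (mul_self_nonneg _) (mul_self_nonneg _)) zero_le_two
        · simp only [S, ← Finset.sum_div, Finset.sum_add_distrib]
          linarith [hProw i, hQrow i]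
        · simp only [S, ← Finset.sum_div, Finset.sum_add_distrib]
          linarith [hPcol j, hQcol j]

theorem tinner_eq_sum_matricize {D : ℕ} {n : Fin D → ℕ} (X Y : (∀ d, Fin (n d)) → ℝ)
    (d : Fin D) : tinner X Y = ∑ k, ∑ j, matricize X d k j * matricize Y d k j := by
  rw [tinner, ← (Equiv.piSplitAt d fun d' => Fin (n d')).symm.sum_comp, Fintype.sum_prod_type]
  have h (k : Fin (n d)) (j : ∀ d' : {d' : Fin D // d' ≠ d}, Fin (n d')) :
      (Equiv.piSplitAt d fun d' => Fin (n d')).symm (k, j) =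
        fun d' => if h : d' = d then Fin.cast (congrArg n h.symm) k else j ⟨d', h⟩ := by
    funext d'
    by_cases h : d' = d
    · subst h
      simp
    · simp [h]
  simp only [h]
  rfl

/-- von Neumann's inequality for tensors, mode by mode. -/
theorem vonNeumann_tensor_mode (D : ℕ) (hD : 1 ≤ D) (n : Fin D → ℕ)
    (X Y : (∀ d, Fin (n d)) → ℝ) (d : Fin D) :
    tinner X Y ≤ ∑ k : Fin (n d), modeSV X d k * modeSV Y d k :=
  (tinner_eq_sum_matricize X Y d).trans_le (sum_sum_mul_le_sum_singularValues _ _)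
end

section
/- (Equality case of von Neumann's trace inequality.) Let A, B ∈ ℝ^{m×n} with m ≤ n. Then trace(Aᵀ · B) = ∑_{k=1}^{m} σ_k(A) · σ_k(B) holds if and only if there exist orthogonal matrices U ∈ ℝ^{m×m} and V ∈ ℝ^{n×n} such that A = U · Diag(σ(A)) · Vᵀ and B = U · Diag(σ(B)) · Vᵀ, where Diag(σ(A)) denotes the m×n rectangular diagonal matrix whose (k,k) entry is σ_k(A) (singular values in nonincreasing order) and all other entries are zero, and similarly for Diag(σ(B)). -/
open scoped BigOperators Matrix

variable {D : ℕ} {n : Fin D → ℕ}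

/-- The `m × n` rectangular diagonal matrix with the entries of `v` on its diagonal. -/
def rectDiag {m n : ℕ} (v : Fin m → ℝ) : Matrix (Fin m) (Fin n) ℝ :=
  Matrix.of fun k j => if (j : ℕ) = (k : ℕ) then v k else 0

theorem sum_mul_le_of_mem_doublyStochastic {N : ℕ} {S : Matrix (Fin N) (Fin N) ℝ}
    (hS : S ∈ doublyStochastic ℝ (Fin N)) {v w : Fin N → ℝ} (hv : Antitone v) (hw : Antitone w) :
    ∑ i, ∑ j, S i j * (v j * w i) ≤ ∑ i, v i * w i := by
  obtain ⟨c, hc0, hc1, rfl⟩ := exists_eq_sum_perm_of_mem_doublyStochastic hS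
  have key : ∀ σ : Equiv.Perm (Fin N),
      ∑ i, ∑ j, σ.permMatrix ℝ i j * (v j * w i) ≤ ∑ i, v i * w i := by
    intro σ
    have h : ∀ i, ∑ j, σ.permMatrix ℝ i j * (v j * w i) = v (σ i) * w i := by
      intro i
      simp [Equiv.Perm.permMatrix, PEquiv.toMatrix_apply]
    simp only [h]
    exact (hv.monovary hw).sum_comp_perm_mul_le_sum_mul
  calc ∑ i, ∑ j, (∑ σ, c σ • σ.permMatrix ℝ) i j * (v j * w i)
      = ∑ σ, c σ * ∑ i, ∑ j, σ.permMatrix ℝ i j * (v j * w i) := by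
        simp only [Matrix.sum_apply, Matrix.smul_apply, smul_eq_mul, Finset.sum_mul,
          Finset.mul_sum, mul_assoc]
        conv_rhs => rw [Finset.sum_comm]
        exact Finset.sum_congr rfl fun i _ => Finset.sum_comm
    _ ≤ ∑ σ, c σ * ∑ i, v i * w i :=
        Finset.sum_le_sum fun σ _ => mul_le_mul_of_nonneg_left (key σ) (hc0 σ)
    _ = ∑ i, v i * w i := by rw [← Finset.sum_mul, hc1, one_mul]

theorem sq_mem_doublyStochastic {N : ℕ} {P : Matrix (Fin N) (Fin N) ℝ} (hP : P * Pᵀ = 1) :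
    (Matrix.of fun i j => P i j ^ 2 : Matrix (Fin N) (Fin N) ℝ) ∈ doublyStochastic ℝ (Fin N) := by
  have hP' : Pᵀ * P = 1 := mul_eq_one_comm.mp hP
  rw [mem_doublyStochastic_iff_sum]
  refine ⟨fun i j => sq_nonneg _, fun i => ?_, fun j => ?_⟩
  · simpa [Matrix.mul_apply, sq] using congrFun (congrFun hP i) i
  · simpa [Matrix.mul_apply, sq] using congrFun (congrFun hP' j) j

theorem sum_sq_mul_le {N : ℕ} {P : Matrix (Fin N) (Fin N) ℝ} (hP : P * Pᵀ = 1)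
    {v w : Fin N → ℝ} (hv : Antitone v) (hw : Antitone w) :
    ∑ i, ∑ j, P i j ^ 2 * (v j * w i) ≤ ∑ i, v i * w i :=
  sum_mul_le_of_mem_doublyStochastic (sq_mem_doublyStochastic hP) hv hw

theorem antitone_append_zero {m k : ℕ} {v : Fin m → ℝ} (hv : Antitone v) (hv0 : ∀ i, 0 ≤ v i) :
    Antitone (Fin.append v (0 : Fin k → ℝ)) := by
  intro i j hij
  induction i using Fin.addCases with
  | left i =>
    induction j using Fin.addCases with
    | left j =>
      simp only [Fin.append_left]
      have h : i ≤ j := hij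
      exact hv h
    | right j => simpa using hv0 i
  | right i =>
    induction j using Fin.addCases with
    | left j =>
      have := Fin.le_def.mp hij
      simp only [Fin.val_natAdd, Fin.val_castAdd] at this
      omega
    | right j => simp

@[simp]
theorem rectDiag_castAdd {m k : ℕ} (v : Fin m → ℝ) (i j : Fin m) :
    rectDiag (n := m + k) v i (Fin.castAdd k j) = if j = i then v i else 0 := by
  simp [rectDiag, Fin.ext_iff]

@[simp]
theorem rectDiag_natAdd {m k : ℕ} (v : Fin m → ℝ) (i : Fin m) (j : Fin k) :
    rectDiag (n := m + k) v i (Fin.natAdd m j) = 0 := by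
  have := i.isLt
  simp only [rectDiag, Matrix.of_apply, Fin.val_natAdd, ite_eq_right_iff]
  omega

theorem rectDiag_add {m n : ℕ} (v w : Fin m → ℝ) :
    rectDiag (n := n) (v + w) = rectDiag v + rectDiag w := by
  ext i j
  simp only [rectDiag, Matrix.of_apply, Matrix.add_apply, Pi.add_apply]
  split_ifs <;> simp

theorem trace_transpose_mul_rectDiag {m k : ℕ} (X : Matrix (Fin m) (Fin (m + k)) ℝ)
    (w : Fin m → ℝ) : (Xᵀ * rectDiag w).trace = ∑ i, X i (Fin.castAdd k i) * w i := by
  simp [Matrix.trace, Matrix.mul_apply, Fin.sum_univ_add]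

theorem trace_transpose_mul_rectDiag_le {m k : ℕ} {P : Matrix (Fin m) (Fin m) ℝ}
    {Q : Matrix (Fin (m + k)) (Fin (m + k)) ℝ} (hP : P * Pᵀ = 1) (hQ : Q * Qᵀ = 1)
    {v w : Fin m → ℝ} (hv : Antitone v) (hw : Antitone w)
    (hv0 : ∀ i, 0 ≤ v i) (hw0 : ∀ i, 0 ≤ w i) :
    ((P * (rectDiag v : Matrix (Fin m) (Fin (m + k)) ℝ) * Qᵀ)ᵀ * rectDiag w).trace ≤
      ∑ i, v i * w i := by
  have hP2 := sum_sq_mul_le hP hv hw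
  have hQ2 := sum_sq_mul_le hQ (antitone_append_zero (k := k) hv hv0)
    (antitone_append_zero (k := k) hw hw0)
  simp only [Fin.sum_univ_add, Fin.append_left, Fin.append_right, Pi.zero_apply, mul_zero,
    zero_mul, Finset.sum_const_zero, add_zero] at hQ2
  have hX : ∀ i, (P * (rectDiag v : Matrix (Fin m) (Fin (m + k)) ℝ) * Qᵀ) i (Fin.castAdd k i) =
      ∑ j, P i j * v j * Q (Fin.castAdd k i) (Fin.castAdd k j) := by
    intro i
    simp [Matrix.mul_apply, Fin.sum_univ_add]
  rw [trace_transpose_mul_rectDiag]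
  have hle : ∑ i, (P * (rectDiag v : Matrix (Fin m) (Fin (m + k)) ℝ) * Qᵀ) i
      (Fin.castAdd k i) * w i ≤
      ∑ i, ∑ j, (P i j ^ 2 * (v j * w i) +
        Q (Fin.castAdd k i) (Fin.castAdd k j) ^ 2 * (v j * w i)) / 2 := by
    refine Finset.sum_le_sum fun i _ => ?_
    rw [hX, Finset.sum_mul]
    refine Finset.sum_le_sum fun j _ => ?_
    nlinarith [mul_nonneg (sq_nonneg (P i j - Q (Fin.castAdd k i) (Fin.castAdd k j)))
      (mul_nonneg (hv0 j) (hw0 i))]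
  simp only [← Finset.sum_div, Finset.sum_add_distrib] at hle
  linarith

theorem trace_transpose_mul_conj {m n : ℕ} {U U' : Matrix (Fin m) (Fin m) ℝ}
    {V V' : Matrix (Fin n) (Fin n) ℝ} (X Y : Matrix (Fin m) (Fin n) ℝ) :
    ((U' * X * V'ᵀ)ᵀ * (U * Y * Vᵀ)).trace =
      ((Uᵀ * U' * X * (Vᵀ * V')ᵀ)ᵀ * Y).trace := by
  simp only [Matrix.transpose_mul, Matrix.transpose_transpose, ← Matrix.mul_assoc]
  rw [Matrix.trace_mul_comm]
  simp only [← Matrix.mul_assoc]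

/-- **Von Neumann's trace inequality** for matrices given by singular value decompositions. -/
theorem trace_transpose_mul_le_of_svd {m k : ℕ} {U U' : Matrix (Fin m) (Fin m) ℝ}
    {V V' : Matrix (Fin (m + k)) (Fin (m + k)) ℝ} (hU : U * Uᵀ = 1) (hU' : U' * U'ᵀ = 1)
    (hV : V * Vᵀ = 1) (hV' : V' * V'ᵀ = 1) {v w : Fin m → ℝ} (hv : Antitone v) (hw : Antitone w)
    (hv0 : ∀ i, 0 ≤ v i) (hw0 : ∀ i, 0 ≤ w i) :
    ((U' * (rectDiag v : Matrix (Fin m) (Fin (m + k)) ℝ) * V'ᵀ)ᵀ *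
      (U * (rectDiag w : Matrix (Fin m) (Fin (m + k)) ℝ) * Vᵀ)).trace ≤
        ∑ i, v i * w i := by
  have orth : ∀ {N : ℕ} {P P' : Matrix (Fin N) (Fin N) ℝ}, P * Pᵀ = 1 → P' * P'ᵀ = 1 →
      (Pᵀ * P') * (Pᵀ * P')ᵀ = 1 := by
    intro N P P' h h'
    rw [Matrix.transpose_mul, Matrix.transpose_transpose, Matrix.mul_assoc,
      ← Matrix.mul_assoc P', h', Matrix.one_mul, mul_eq_one_comm.mp h]
  rw [trace_transpose_mul_conj]
  exact trace_transpose_mul_rectDiag_le (orth hU hU') (orth hV hV') hv hw hv0 hw0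

theorem trace_transpose_mul_eq_of_svd {m k : ℕ} {U : Matrix (Fin m) (Fin m) ℝ}
    {V : Matrix (Fin (m + k)) (Fin (m + k)) ℝ} (hU : U * Uᵀ = 1)
    (hV : V * Vᵀ = 1) (v w : Fin m → ℝ) :
    ((U * (rectDiag v : Matrix (Fin m) (Fin (m + k)) ℝ) * Vᵀ)ᵀ *
      (U * (rectDiag w : Matrix (Fin m) (Fin (m + k)) ℝ) * Vᵀ)).trace =
        ∑ i, v i * w i := by
  rw [trace_transpose_mul_conj, mul_eq_one_comm.mp hU, mul_eq_one_comm.mp hV,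
    trace_transpose_mul_rectDiag]
  simp

theorem singularValues_nonneg {m : ℕ} {J : Type*} [Fintype J] (A : Matrix (Fin m) J ℝ)
    (i : Fin m) : 0 ≤ singularValues A i :=
  Real.sqrt_nonneg _

theorem exists_orthogonal_diagonalizing_gram {m : ℕ} {J : Type*} [Fintype J]
    (A : Matrix (Fin m) J ℝ) :
    ∃ U : Matrix (Fin m) (Fin m) ℝ, U * Uᵀ = 1 ∧
      Uᵀ * (A * Aᵀ) * U = Matrix.diagonal fun i => singularValues A i ^ 2 := by
  classical
  set hA := gram_isHermitian A
  set W : Matrix (Fin m) (Fin m) ℝ := (hA.eigenvectorUnitary : Matrix (Fin m) (Fin m) ℝ)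
  have hWW : W * Wᵀ = 1 := by
    have := Unitary.mul_star_self_of_mem hA.eigenvectorUnitary.2
    simpa [Matrix.star_eq_conjTranspose, Matrix.conjTranspose_eq_transpose_of_trivial] using this
  have hdiag : Wᵀ * (A * Aᵀ) * W = Matrix.diagonal hA.eigenvalues := by
    have := hA.conjStarAlgAut_star_eigenvectorUnitary
    simpa [Unitary.conjStarAlgAut_apply, Matrix.star_eq_conjTranspose,
      Matrix.conjTranspose_eq_transpose_of_trivial, Function.comp_def] using this
  have hpos : ∀ i, 0 ≤ hA.eigenvalues i := by
    have : (A * Aᵀ).PosSemidef := by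
      simpa [Matrix.conjTranspose_eq_transpose_of_trivial] using
        Matrix.posSemidef_self_mul_conjTranspose A
    exact this.eigenvalues_nonneg
  let e : Fin m ≃ Fin m := Fin.revPerm.trans (Tuple.sort hA.eigenvalues)
  refine ⟨W.submatrix id e, ?_, ?_⟩
  · rw [Matrix.transpose_submatrix, Matrix.submatrix_mul_equiv, hWW]
    simp
  · have hsq : (fun i => singularValues A i ^ 2) = hA.eigenvalues ∘ e := by
      funext i
      exact Real.sq_sqrt (hpos _)
    rw [hsq, ← Matrix.submatrix_diagonal_equiv, ← hdiag]
    ext i j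
    simp [Matrix.mul_apply]

/-- Existence of the singular value decomposition. -/
theorem exists_svd {m k : ℕ} (A : Matrix (Fin m) (Fin (m + k)) ℝ) :
    ∃ (U : Matrix (Fin m) (Fin m) ℝ) (V : Matrix (Fin (m + k)) (Fin (m + k)) ℝ),
      U * Uᵀ = 1 ∧ V * Vᵀ = 1 ∧
        A = U * (rectDiag (singularValues A) : Matrix (Fin m) (Fin (m + k)) ℝ) * Vᵀ := by
  obtain ⟨U, hU, hdiag⟩ := exists_orthogonal_diagonalizing_gram A
  set s := singularValues A
  set R := Uᵀ * A with hR
  have hRR : R * Rᵀ = Matrix.diagonal fun i => s i ^ 2 := by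
    rw [← hdiag, hR, Matrix.transpose_mul, Matrix.transpose_transpose]
    simp only [Matrix.mul_assoc]
  have hdot : ∀ i j, ∑ l, R i l * R j l = if i = j then s i ^ 2 else 0 := by
    intro i j
    simpa [Matrix.mul_apply, Matrix.diagonal_apply] using congrFun (congrFun hRR i) j
  let f : Fin (m + k) → EuclideanSpace ℝ (Fin (m + k)) :=
    Fin.append (fun i => WithLp.toLp 2 fun l => (s i)⁻¹ * R i l) (fun _ => 0)
  let S : Set (Fin (m + k)) := {j | ∃ i, s i ≠ 0 ∧ j = Fin.castAdd k i}
  have hf : Orthonormal ℝ (S.domRestrict f) := by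
    rw [orthonormal_iff_ite]
    rintro ⟨_, i, hi, rfl⟩ ⟨_, j, hj, rfl⟩
    have : ∑ l, (s i)⁻¹ * R i l * ((s j)⁻¹ * R j l) = if i = j then 1 else 0 := by
      calc ∑ l, (s i)⁻¹ * R i l * ((s j)⁻¹ * R j l)
          = (s i)⁻¹ * (s j)⁻¹ * ∑ l, R i l * R j l := by
            rw [Finset.mul_sum]
            exact Finset.sum_congr rfl fun l _ => by ring
        _ = if i = j then 1 else 0 := by
            rw [hdot]
            split_ifs with h
            · subst h
              field_simp
            · simp
    simpa [f, PiLp.inner_apply, mul_comm] using this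
  obtain ⟨b, hb⟩ := hf.exists_orthonormalBasis_extension_of_card_eq (by simp)
  refine ⟨U, Matrix.of fun l j => b j l, hU, ?_, ?_⟩
  · refine mul_eq_one_comm.mp ?_
    ext i j
    have := orthonormal_iff_ite.mp b.orthonormal i j
    simpa [Matrix.mul_apply, Matrix.one_apply, PiLp.inner_apply, mul_comm] using this
  · have hA : A = U * R := by rw [hR, ← Matrix.mul_assoc, hU, Matrix.one_mul]
    rw [Matrix.mul_assoc]
    conv_lhs => rw [hA]
    congr 1
    ext i l
    have hrow : R i l = s i * b (Fin.castAdd k i) l := by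
      by_cases hi : s i = 0
      · have h0 := hdot i i
        simp only [if_true, hi] at h0
        have := (Finset.sum_eq_zero_iff_of_nonneg fun l _ => mul_self_nonneg (R i l)).mp
          (h0.trans (by norm_num)) l (Finset.mem_univ l)
        rw [mul_self_eq_zero.mp this, hi, zero_mul]
      · rw [hb _ ⟨i, hi, rfl⟩]
        simp [f, hi]
    simp [Matrix.mul_apply, Fin.sum_univ_add, hrow]

theorem trace_eq_sum_singularValues_iff_exists_svd {m k : ℕ}
    (A B : Matrix (Fin m) (Fin (m + k)) ℝ) :
    (Aᵀ * B).trace = ∑ i, singularValues A i * singularValues B i ↔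
      ∃ (U : Matrix (Fin m) (Fin m) ℝ) (V : Matrix (Fin (m + k)) (Fin (m + k)) ℝ),
        U * Uᵀ = 1 ∧ V * Vᵀ = 1 ∧
        A = U * (rectDiag (singularValues A) : Matrix (Fin m) (Fin (m + k)) ℝ) * Vᵀ ∧
        B = U * (rectDiag (singularValues B) : Matrix (Fin m) (Fin (m + k)) ℝ) * Vᵀ := by
  constructor
  · intro hAB
    obtain ⟨UA, VA, hUA, hVA, hA⟩ := exists_svd A
    obtain ⟨UB, VB, hUB, hVB, hB⟩ := exists_svd B
    obtain ⟨U, V, hU, hV, hC⟩ := exists_svd (A + B)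
    have ha := antitone_singularValues A
    have hb := antitone_singularValues B
    have hc := antitone_singularValues (A + B)
    have ha0 := singularValues_nonneg A
    have hb0 := singularValues_nonneg B
    have hc0 := singularValues_nonneg (A + B)
    have hAA := trace_transpose_mul_eq_of_svd hUA hVA (singularValues A) (singularValues A)
    have hBB := trace_transpose_mul_eq_of_svd hUB hVB (singularValues B) (singularValues B)
    have hCC := trace_transpose_mul_eq_of_svd hU hV (singularValues (A + B))
      (singularValues (A + B))
    have hAC := trace_transpose_mul_le_of_svd hU hUA hV hVA ha hc ha0 hc0
    have hBC := trace_transpose_mul_le_of_svd hU hUB hV hVB hb hc hb0 hc0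
    have hAA' := trace_transpose_mul_le_of_svd hU hUA hV hVA ha ha ha0 ha0
    have hAB' := trace_transpose_mul_le_of_svd hU hUA hV hVA ha hb ha0 hb0
    have hA'A' := trace_transpose_mul_eq_of_svd hU hV (singularValues A) (singularValues A)
    rw [← hA] at hAA hAC hAA' hAB'
    rw [← hB] at hBB hBC
    rw [← hC] at hCC hAC hBC
    generalize singularValues A = a at *
    generalize singularValues B = b at *
    generalize singularValues (A + B) = c at *
    have hBA : (Bᵀ * A).trace = (Aᵀ * B).trace := by
      rw [← Matrix.trace_transpose, Matrix.transpose_mul, Matrix.transpose_transpose]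
    simp only [Matrix.transpose_add, Matrix.add_mul, Matrix.mul_add, Matrix.trace_add]
      at hCC hAC hBC
    have hsum : ∑ i, (c i - (a i + b i)) ^ 2 = ∑ i, c i * c i - 2 * ∑ i, a i * c i
        - 2 * ∑ i, b i * c i + ∑ i, a i * a i + 2 * ∑ i, a i * b i + ∑ i, b i * b i := by
      simp only [Finset.mul_sum, ← Finset.sum_add_distrib, ← Finset.sum_sub_distrib]
      exact Finset.sum_congr rfl fun i _ => by ring
    have hcab : c = a + b := by
      have h0 : ∑ i, (c i - (a i + b i)) ^ 2 = 0 :=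
        le_antisymm (by linarith) (Finset.sum_nonneg fun i _ => sq_nonneg _)
      funext i
      have := (Finset.sum_eq_zero_iff_of_nonneg fun i _ => sq_nonneg _).mp h0 i
        (Finset.mem_univ i)
      exact sub_eq_zero.mp (pow_eq_zero_iff two_ne_zero |>.mp this)
    rw [hcab, rectDiag_add, Matrix.mul_add, Matrix.add_mul] at hC
    set A' := U * (rectDiag a : Matrix (Fin m) (Fin (m + k)) ℝ) * Vᵀ
    set B' := U * (rectDiag b : Matrix (Fin m) (Fin (m + k)) ℝ) * Vᵀ
    have hsplit : (Aᵀ * A).trace + (Aᵀ * B).trace = (Aᵀ * A').trace + (Aᵀ * B').trace := by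
      rw [← Matrix.trace_add, ← Matrix.mul_add, hC, Matrix.mul_add, Matrix.trace_add]
    have hA'A : (A'ᵀ * A).trace = (Aᵀ * A').trace := by
      rw [← Matrix.trace_transpose, Matrix.transpose_mul, Matrix.transpose_transpose]
    have hdist : ((A - A')ᵀ * (A - A')).trace = 0 := by
      simp only [Matrix.transpose_sub, Matrix.sub_mul, Matrix.mul_sub, Matrix.trace_sub]
      linarith
    have hAeq : A = A' := by
      rw [← Matrix.conjTranspose_eq_transpose_of_trivial,
        Matrix.trace_conjTranspose_mul_self_eq_zero_iff] at hdist
      exact sub_eq_zero.mp hdist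
    refine ⟨U, V, hU, hV, hAeq, ?_⟩
    have : A + B = A + B' := by rw [hC, ← hAeq]
    exact add_left_cancel this
  · rintro ⟨U, V, hU, hV, hA, hB⟩
    have := trace_transpose_mul_eq_of_svd hU hV (singularValues A) (singularValues B)
    rwa [← hA, ← hB] at this

/-- equality case of von Neumann's trace inequality. -/
theorem vonNeumann_trace_equality_iff (m n : ℕ) (hmn : m ≤ n)
    (A B : Matrix (Fin m) (Fin n) ℝ) :
    (Aᵀ * B).trace = ∑ k : Fin m, singularValues A k * singularValues B k ↔
      ∃ (U : Matrix (Fin m) (Fin m) ℝ) (V : Matrix (Fin n) (Fin n) ℝ),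
        U * Uᵀ = 1 ∧ V * Vᵀ = 1 ∧
        A = U * rectDiag (singularValues A) * Vᵀ ∧
        B = U * rectDiag (singularValues B) * Vᵀ := by
  obtain ⟨k, rfl⟩ := Nat.exists_eq_add_of_le hmn
  exact trace_eq_sum_singularValues_iff_exists_svd A B
end

section
/- Let X, Y be order-D real tensors of the same size, and suppose that for every mode d there exist orthogonal matrices U^(d) and V^(d) with X_(d) = U^(d) · Diag(σ^(d)(X)) · (V^(d))ᵀ and Y_(d) = U^(d) · Diag(σ^(d)(Y)) · (V^(d))ᵀ (simultaneous ordered singular value decompositions of all matricizations). Define the cores S_X = X ×_1 (U^(1))ᵀ ⋯ ×_D (U^(D))ᵀ and S_Y = Y ×_1 (U^(1))ᵀ ⋯ ×_D (U^(D))ᵀ. Then for every multi-index (i_1,…,i_D) and every mode d, σ^(d)_{i_d}(Y) · (S_X)_{i_1,…,i_D} = σ^(d)_{i_d}(X) · (S_Y)_{i_1,…,i_D}. -/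
open scoped BigOperators Matrix

variable {D : ℕ} {n : Fin D → ℕ}

/-- The Tucker product, with the summation over mode `d` expressed as multiplication of the
mode-`d` matricization. -/
theorem tuckerMul_eq_sum_mul_matricize {D : ℕ} {n : Fin D → ℕ} (X : (∀ d, Fin (n d)) → ℝ)
    (W : ∀ d, Matrix (Fin (n d)) (Fin (n d)) ℝ) (i : ∀ d, Fin (n d)) (d : Fin D) :
    tuckerMul X W i =
      ∑ j : ∀ d' : {d' : Fin D // d' ≠ d}, Fin (n d'),
        (∏ d' : {d' : Fin D // d' ≠ d}, W d' (i d') (j d')) *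
          (W d * matricize X d) (i d) j := by
  unfold tuckerMul
  rw [← (Equiv.piSplitAt d (fun d' => Fin (n d'))).symm.sum_comp, Fintype.sum_prod_type_right]
  refine Finset.sum_congr rfl fun j _ => ?_
  rw [Matrix.mul_apply, Finset.mul_sum]
  refine Finset.sum_congr rfl fun k _ => ?_
  have hX : matricize X d k j = X ((Equiv.piSplitAt d (fun d' => Fin (n d'))).symm (k, j)) := by
    simp only [matricize, Matrix.of_apply]
    congr 1
    funext d'
    by_cases h : d' = d
    · subst h
      simp
    · simp [h]
  rw [hX, Fintype.prod_eq_mul_prod_subtype_ne _ d]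
  have hprod : ∀ d' : {d' : Fin D // d' ≠ d},
      (Equiv.piSplitAt d (fun d' => Fin (n d'))).symm (k, j) d' = j d' := fun d' => by
    simp [d'.2]
  simp only [hprod]
  simp
  ring

/-- Left multiplication by `Uᵀ` cancels the orthogonal left factor, and the rows of the result
are scaled by the diagonal entries. -/
theorem transpose_mul_rectDiagJ_proportional {m : ℕ} {J : Type*} [Fintype J]
    {U : Matrix (Fin m) (Fin m) ℝ} (hU : U * Uᵀ = 1) {V : Matrix J J ℝ}
    {v w : Fin m → ℝ} {A B : Matrix (Fin m) J ℝ}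
    (hA : A = U * (rectDiagJ v : Matrix (Fin m) J ℝ) * Vᵀ)
    (hB : B = U * (rectDiagJ w : Matrix (Fin m) J ℝ) * Vᵀ) (k : Fin m) (j : J) :
    w k * (Uᵀ * A) k j = v k * (Uᵀ * B) k j := by
  have hU' : Uᵀ * U = 1 := mul_eq_one_comm.mp hU
  rw [hA, hB, Matrix.mul_assoc, ← Matrix.mul_assoc, hU', Matrix.one_mul, Matrix.mul_assoc U,
    ← Matrix.mul_assoc, hU', Matrix.one_mul, Matrix.mul_apply, Matrix.mul_apply,
    Finset.mul_sum, Finset.mul_sum]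
  refine Finset.sum_congr rfl fun l _ => ?_
  simp only [rectDiagJ, Matrix.of_apply]
  split_ifs
  · ring
  · simp

/-- proportionality of the entries of the cores under simultaneous
ordered SVDs of all matricizations. -/
theorem core_entries_proportional (D : ℕ) (hD : 1 ≤ D) (n : Fin D → ℕ)
    (X Y : (∀ d, Fin (n d)) → ℝ)
    (U : ∀ d, Matrix (Fin (n d)) (Fin (n d)) ℝ)
    (hU : ∀ d, U d * (U d)ᵀ = 1)
    (hSVD : ∀ d : Fin D,
      ∃ V : Matrix (∀ d' : {d' : Fin D // d' ≠ d}, Fin (n d'))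
                   (∀ d' : {d' : Fin D // d' ≠ d}, Fin (n d')) ℝ,
        V * Vᵀ = 1 ∧
        matricize X d = U d * rectDiagJ (modeSV X d) * Vᵀ ∧
        matricize Y d = U d * rectDiagJ (modeSV Y d) * Vᵀ) :
    ∀ (i : ∀ d, Fin (n d)) (d : Fin D),
      modeSV Y d (i d) * tuckerMul X (fun d' => (U d')ᵀ) i
        = modeSV X d (i d) * tuckerMul Y (fun d' => (U d')ᵀ) i := by
  intro i d
  obtain ⟨V, -, hX, hY⟩ := hSVD d
  rw [tuckerMul_eq_sum_mul_matricize X _ i d, tuckerMul_eq_sum_mul_matricize Y _ i d,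
    Finset.mul_sum, Finset.mul_sum]
  refine Finset.sum_congr rfl fun j _ => ?_
  rw [mul_left_comm, transpose_mul_rectDiagJ_proportional (hU d) hX hY, mul_left_comm]
end
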